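/- arXiv:1912.06909 — 2 statements merged into one kernel-verified Lean document; each statement's English description precedes it below -/
import Mathlib

section
/- For every preference profile P that is single-peaked with respect to ≺, every endowment profile ω, and every agent i, the crawler meets the endowment lower bound: CR_i(P,ω) R_i ω_i. -/
/- Preferences are given by rank functions: `rk i o` is agent `i`'s rank of object `o`
(lower rank = more preferred), so `o P_i o'` iff `rk i o < rk i o'`. -/

/-- Find the smallest index `t` such that the `t`-th agent prefers the `t`-th object
to the `(t+1)`-st object; the last index always qualifies. -/
def findIdx2 {n : ℕ} (rk : Fin n → Fin n → Fin n) : List (Fin n) → List (Fin n) → ℕ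
  | a :: as, o1 :: o2 :: os =>
      if rk a o1 < rk a o2 then 0 else findIdx2 rk as (o2 :: os) + 1
  | _, _ => 0

/-- One run of the (ascending) crawler: `agents` is the list of remaining agents in the
order of their current ownership, `objects` the list of remaining objects in increasing
`≺`-order (the `t`-th agent currently owns the `t`-th object). -/
def crawlAux {n : ℕ} (rk : Fin n → Fin n → Fin n) :
    ℕ → List (Fin n) → List (Fin n) → List (Fin n × Fin n)
  | 0, _, _ => []
  | fuel + 1, agents, objects =>
    match agents, objects with
    | a0 :: _, o0 :: _ =>
      let t := findIdx2 rk agents objects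
      let a := agents.getD t a0
      let ostar := (objects.argmin (rk a)).getD o0
      (a, ostar) :: crawlAux rk fuel (agents.eraseIdx t) (objects.erase ostar)
    | _, _ => []

/-- Agents listed in increasing order of their endowments. -/
def ownersList {n : ℕ} (ω : Fin n → Fin n) : List (Fin n) :=
  (List.finRange n).filterMap fun o => (List.finRange n).find? fun a => ω a == o

/-- The (ascending) crawler allocation. -/
def CRfun {n : ℕ} (rk : Fin n → Fin n → Fin n) (ω : Fin n → Fin n) (i : Fin n) : Fin n :=
  ((crawlAux rk n (ownersList ω) (List.finRange n)).lookup i).getD (ω i)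

/-- The descending crawler: the mirror image of the ascending crawler, obtained by
reversing the order `≺` on objects. -/
def DCRfun {n : ℕ} (rk : Fin n → Fin n → Fin n) (ω : Fin n → Fin n) (i : Fin n) : Fin n :=
  Fin.rev (CRfun (fun j o => rk j o.rev) (fun j => (ω j).rev) i)

/-- Sequential priority: agents in the given list pick, in order, their most
preferred remaining object. -/
def SPAux {n : ℕ} (rk : Fin n → Fin n → Fin n) :
    List (Fin n) → List (Fin n) → List (Fin n × Fin n)
  | [], _ => []
  | _ :: _, [] => []
  | a :: as, o0 :: os =>
      let o := ((o0 :: os).argmin (rk a)).getD o0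
      (a, o) :: SPAux rk as ((o0 :: os).erase o)

/-- The sequential priority rule induced by the order `f` (agent `f k` has priority `k`). -/
def SPfun {n : ℕ} (rk : Fin n → Fin n → Fin n) (f : Fin n → Fin n) (i : Fin n) : Fin n :=
  ((SPAux rk ((List.finRange n).map f) (List.finRange n)).lookup i).getD i

/-- Top trading cycles: `own` maps each remaining object to its (initial) owner. -/
def TTCAux {n : ℕ} (rk : Fin n → Fin n → Fin n) :
    ℕ → List (Fin n) → List (Fin n) → (Fin n → Fin n) → List (Fin n × Fin n)
  | 0, _, _, _ => []
  | fuel + 1, agents, objects, own =>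
    match agents with
    | [] => []
    | a0 :: _ =>
      let top : Fin n → Fin n := fun a => (objects.argmin (rk a)).getD a0
      let ptr : Fin n → Fin n := fun a => own (top a)
      let onCyc : Fin n → Bool := fun a =>
        (List.range agents.length).any fun k => ptr^[k + 1] a == a
      let cyc := agents.filter onCyc
      let assigned := cyc.map top
      (cyc.map fun a => (a, top a)) ++
        TTCAux rk fuel (agents.filter fun a => !onCyc a)
          (objects.filter fun o => !(assigned.contains o)) own

/-- The top trading cycles allocation from endowments `ω`. -/
def TTCfun {n : ℕ} (rk : Fin n → Fin n → Fin n) (ω : Equiv.Perm (Fin n)) (i : Fin n) : Fin n :=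
  ((TTCAux rk n (List.finRange n) (List.finRange n) ω.symm).lookup i).getD (ω i)

/-- A profile of strict preferences (given as rank permutations) is single-peaked
with respect to the order on `Fin n`. -/
def SinglePeaked {n : ℕ} (P : Fin n → Equiv.Perm (Fin n)) : Prop :=
  ∀ i : Fin n, ∃ p : Fin n, ∀ o o' : Fin n,
    ((o' < o ∧ o ≤ p) ∨ (p ≤ o ∧ o < o')) → P i o < P i o'

/-- Pareto efficiency of an allocation `x` at the profile `P`. -/
def ParetoEfficient {n : ℕ} (P : Fin n → Equiv.Perm (Fin n)) (x : Fin n → Fin n) : Prop :=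
  ¬ ∃ y : Equiv.Perm (Fin n),
      (∀ i, P i (y i) ≤ P i (x i)) ∧ ∃ j, P j (y j) < P j (x j)

theorem findIdx2_lt_length {n : ℕ} (rk : Fin n → Fin n → Fin n) :
    ∀ agents objects : List (Fin n), agents.length = objects.length → agents ≠ [] →
      findIdx2 rk agents objects < agents.length
  | [], _, _, h => absurd rfl h
  | [_], [_], _, _ => by simp [findIdx2]
  | a :: b :: as, o1 :: o2 :: os, hl, _ => by
      have ih := findIdx2_lt_length rk (b :: as) (o2 :: os) (by simpa using hl) (by simp)
      rw [findIdx2]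
      split
      · simp
      · simpa using ih

/-- Every agent before the selected one weakly prefers the next object to the current one. -/
theorem le_of_lt_findIdx2 {n : ℕ} (rk : Fin n → Fin n → Fin n) :
    ∀ (agents objects : List (Fin n)) (s : ℕ) (a o o' : Fin n),
      s < findIdx2 rk agents objects → agents[s]? = some a → objects[s]? = some o →
      objects[s + 1]? = some o' → rk a o' ≤ rk a o
  | b :: as, o1 :: o2 :: os, s, a, o, o', hs, ha, ho, ho' => by
      rw [findIdx2] at hs
      split at hs
      · omega
      · rename_i hlt
        cases s with
        | zero =>
          simp only [List.getElem?_cons_zero, List.getElem?_cons_succ, Option.some.injEq] at ha ho ho'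
          subst ha ho ho'
          exact not_lt.mp hlt
        | succ s =>
          exact le_of_lt_findIdx2 rk as (o2 :: os) s a o o' (by omega) (by simpa using ha)
            (by simpa using ho) (by simpa using ho')
  | [], _, _, _, _, _, _, ha, _, _ => by simp at ha
  | _ :: _, [], _, _, _, _, _, _, ho, _ => by simp at ho
  | _ :: _, [_], _, _, _, _, _, _, _, ho' => by simp at ho'

/-- The selected agent prefers the current object to the next one. -/
theorem lt_of_findIdx2 {n : ℕ} (rk : Fin n → Fin n → Fin n) :
    ∀ (agents objects : List (Fin n)) (a o o' : Fin n),
      agents[findIdx2 rk agents objects]? = some a →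
      objects[findIdx2 rk agents objects]? = some o →
      objects[findIdx2 rk agents objects + 1]? = some o' → rk a o < rk a o'
  | b :: as, o1 :: o2 :: os, a, o, o', ha, ho, ho' => by
      rw [findIdx2] at ha ho ho'
      split at ha
      · rename_i hlt
        simp only [if_pos hlt, List.getElem?_cons_zero, List.getElem?_cons_succ,
          Option.some.injEq, zero_add] at ha ho ho'
        subst ha ho ho'
        exact hlt
      · rename_i hlt
        simp only [if_neg hlt] at ho ho'
        exact lt_of_findIdx2 rk as (o2 :: os) a o o' (by simpa using ha)
          (by simpa using ho) (by simpa using ho')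
  | [], _, _, _, _, ha, _, _ => by simp at ha
  | _ :: _, [], _, _, _, _, ho, _ => by simp at ho
  | _ :: _, [_], _, _, _, _, _, ho' => by simp [findIdx2] at ho'

/-- The best remaining object of the selected agent is not to the right of his current object. -/
theorem idxOf_argmin_le_findIdx2 {n : ℕ} {rk : Fin n → Fin n → Fin n}
    {agents objects : List (Fin n)} {a m p : Fin n}
    (hp : ∀ o o' : Fin n, ((o' < o ∧ o ≤ p) ∨ (p ≤ o ∧ o < o')) → rk a o < rk a o')
    (hsort : objects.Pairwise (· < ·))
    (ha : agents[findIdx2 rk agents objects]? = some a)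
    (hm : m ∈ objects.argmin (rk a)) :
    objects.idxOf m ≤ findIdx2 rk agents objects := by
  by_contra! hlt
  have hnext := lt_of_findIdx2 rk agents objects a
  generalize findIdx2 rk agents objects = t at *
  have hmem : m ∈ objects := List.argmin_mem hm
  have hj : objects.idxOf m < objects.length := List.idxOf_lt_length_iff.mpr hmem
  have h1 := hnext objects[t] objects[t + 1] ha (by simp) (by simp)
  have h12 : objects[t] < objects[t + 1] :=
    List.pairwise_iff_getElem.mp hsort t (t + 1) (by omega) (by omega) (by omega)
  have hp1 : p < objects[t + 1] := by
    by_contra! hle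
    exact lt_asymm h1 (hp _ _ (Or.inl ⟨h12, hle⟩))
  have h2m : rk a objects[t + 1] ≤ rk a m := by
    rcases eq_or_lt_of_le (Nat.succ_le_of_lt hlt) with heq | hgt
    · have : objects[t + 1] = m := by
        have := List.getElem_idxOf hj
        simp only [← heq] at this
        exact this
      rw [this]
    · have := List.pairwise_iff_getElem.mp hsort (t + 1) (objects.idxOf m) (by omega) hj hgt
      rw [List.getElem_idxOf hj] at this
      exact (hp _ _ (Or.inr ⟨hp1.le, this⟩)).le
  exact absurd (h1.trans_le h2m)
    (not_lt.mpr (List.le_of_mem_argmin (List.getElem_mem (by omega : t < objects.length)) hm))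

/-- An agent who receives an object in a run of the crawler finds it at least as desirable as the
object owned when the run starts. -/
theorem le_of_lookup_crawlAux {n : ℕ} {rk : Fin n → Fin n → Fin n}
    (hrk : ∀ i : Fin n, ∃ p : Fin n, ∀ o o' : Fin n,
      ((o' < o ∧ o ≤ p) ∨ (p ≤ o ∧ o < o')) → rk i o < rk i o') :
    ∀ (fuel : ℕ) (agents objects : List (Fin n)) (k : ℕ) (i e o : Fin n),
      agents.length = objects.length → objects.Pairwise (· < ·) →
      agents[k]? = some i → objects[k]? = some e →
      (crawlAux rk fuel agents objects).lookup i = some o → rk i o ≤ rk i e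
  | 0, _, _, _, _, _, _, _, _, _, _, h => by simp [crawlAux] at h
  | _ + 1, [], _, _, _, _, _, _, _, hi, _, _ => by simp at hi
  | _ + 1, _ :: _, [], _, _, _, _, hl, _, _, _, _ => by simp at hl
  | fuel + 1, a0 :: as, o0 :: os, k, i, e, o, hl, hsort, hi, he, h => by
    rw [crawlAux] at h
    generalize hA : a0 :: as = agents at *
    generalize hO : o0 :: os = objects at *
    have hlt := findIdx2_lt_length rk agents objects hl (by simp [← hA])
    have ha : agents[findIdx2 rk agents objects]? =
        some (agents.getD (findIdx2 rk agents objects) a0) := by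
      simp [List.getD_eq_getElem?_getD, hlt]
    generalize agents.getD (findIdx2 rk agents objects) a0 = a at *
    obtain ⟨m, hm⟩ : ∃ m, objects.argmin (rk a) = some m := by
      refine Option.ne_none_iff_exists'.mp ?_
      simp [List.argmin_eq_none, ← hO]
    obtain ⟨p, hp⟩ := hrk a
    have hle := idxOf_argmin_le_findIdx2 hp hsort ha hm
    simp only [hm, Option.getD_some, List.lookup_cons] at h
    have hmem : m ∈ objects := List.argmin_mem hm
    by_cases hia : i = a
    · subst hia
      simp only [beq_self_eq_true] at h
      obtain rfl := Option.some.inj h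
      exact List.le_of_mem_argmin (List.mem_of_getElem? he) hm
    · rw [beq_false_of_ne hia] at h
      simp only at h
      have hkt : k ≠ findIdx2 rk agents objects := by
        rintro rfl
        exact hia (Option.some.inj (hi.symm.trans ha))
      have hlen : (agents.eraseIdx (findIdx2 rk agents objects)).length =
          (objects.erase m).length := by
        rw [List.length_eraseIdx_of_lt hlt, List.length_erase_of_mem hmem, hl]
      have ih := fun k e hi he => le_of_lookup_crawlAux hrk fuel _ (objects.erase m) k i e o hlen
        (hsort.sublist List.erase_sublist) hi he h
      rw [List.erase_eq_eraseIdx_of_idxOf rfl] at ih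
      simp only [List.getElem?_eraseIdx] at ih
      rcases lt_or_gt_of_ne hkt with hk | hk
      · by_cases hkj : k < objects.idxOf m
        · exact ih k e (by rw [if_pos hk, hi]) (by rw [if_pos hkj, he])
        · have hk1 : objects[k + 1]? = some (objects[k + 1]'(by omega)) := by simp
          exact (ih k _ (by rw [if_pos hk, hi]) (by rw [if_neg hkj, hk1])).trans
            (le_of_lt_findIdx2 rk agents objects k i e _ hk hi he hk1)
      · obtain ⟨k, rfl⟩ : ∃ k', k = k' + 1 := ⟨k - 1, by omega⟩
        exact ih k e (by rw [if_neg (by omega), hi]) (by rw [if_neg (by omega), he])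

theorem ownersList_eq_map {n : ℕ} (ω : Equiv.Perm (Fin n)) :
    ownersList ω = (List.finRange n).map ω.symm := by
  rw [ownersList, ← List.filterMap_eq_map]
  congr 1
  funext o
  have hs : ((List.finRange n).find? fun a => ω a == o).isSome := by
    rw [List.find?_isSome]
    exact ⟨ω.symm o, List.mem_finRange _, by simp⟩
  obtain ⟨b, hb⟩ := Option.isSome_iff_exists.mp hs
  have hbo : ω b = o := by simpa using List.find?_some hb
  rw [hb, ← hbo, Function.comp_apply, Equiv.symm_apply_apply]

/-- the crawler meets the endowment lower bound: each agent finds his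
crawler assignment at least as desirable as his endowment (i.e. its rank is at most
the rank of his endowment). -/
theorem crawler_endowment_lower_bound {n : ℕ} (hn : 1 ≤ n)
    (P : Fin n → Equiv.Perm (Fin n)) (hP : SinglePeaked P) (ω : Equiv.Perm (Fin n))
    (i : Fin n) :
    P i (CRfun (fun j => ⇑(P j)) ⇑ω i) ≤ P i (ω i) := by
  rw [CRfun]
  cases h : (crawlAux (fun j => ⇑(P j)) n (ownersList ω) (List.finRange n)).lookup i with
  | none => simp
  | some o =>
    exact le_of_lookup_crawlAux hP n _ _ (ω i) i (ω i) o (by simp [ownersList_eq_map])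
      (List.pairwise_lt_finRange n) (by simp [ownersList_eq_map]) (by simp) h
end

section
/- For every strict preference profile P and every endowment profile ω, the core of the object reallocation problem (P,ω) is a singleton, and its unique element is the Top Trading Cycles allocation TTC^ω(P). -/
/-- Allocation `x` is blocked by coalition `N'` at `(P,ω)`: some reassignment `y` of
the coalition's endowments among its members makes everyone weakly better off and
someone strictly better off. -/
def Blocks {n : ℕ} (P : Fin n → Equiv.Perm (Fin n)) (ω : Equiv.Perm (Fin n))
    (x : Fin n → Fin n) (N' : Finset (Fin n)) : Prop :=
  ∃ y : Fin n → Fin n, Set.InjOn y ↑N' ∧ N'.image y = N'.image ⇑ω ∧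
    (∀ i ∈ N', P i (y i) ≤ P i (x i)) ∧ ∃ j ∈ N', P j (y j) < P j (x j)

/-- An allocation is in the core of `(P,ω)` if no coalition blocks it. -/
def InCore {n : ℕ} (P : Fin n → Equiv.Perm (Fin n)) (ω : Equiv.Perm (Fin n))
    (x : Equiv.Perm (Fin n)) : Prop :=
  ∀ N' : Finset (Fin n), ¬ Blocks P ω ⇑x N'

/-- On the set `A` of agents, `x` arises by trading in stages: `s i` is the stage at which
`i` trades, trade happens within stages, and everyone gets his best object among those whose
owners have not traded at an earlier stage. -/
structure TradesInStages {n : ℕ} (P : Fin n → Equiv.Perm (Fin n)) (ω : Equiv.Perm (Fin n))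
    (A : Set (Fin n)) (s : Fin n → ℕ) (x : Fin n → Fin n) : Prop where
  mapsTo : ∀ i ∈ A, ω.symm (x i) ∈ A
  stage_eq : ∀ i ∈ A, s (ω.symm (x i)) = s i
  injOn : Set.InjOn x A
  best : ∀ i ∈ A, ∀ j ∈ A, s i ≤ s j → P i (x i) ≤ P i (ω j)

/-- If a coalition trades as in `x` at all stages before `k`, then its other members receive
endowments of agents whose stage is at least `k`. -/
theorem TradesInStages.le_stage_of_eq {n : ℕ} {P : Fin n → Equiv.Perm (Fin n)}
    {ω : Equiv.Perm (Fin n)} {s : Fin n → ℕ} {x : Fin n → Fin n}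
    (h : TradesInStages P ω Set.univ s x) {N : Finset (Fin n)} {y : Fin n → Fin n}
    (hinj : Set.InjOn y N) (hN : ∀ i ∈ N, ω.symm (y i) ∈ N) {k : ℕ}
    (hlt : ∀ i ∈ N, s i < k → y i = x i) {i : Fin n} (hi : i ∈ N) (hk : k ≤ s i) :
    k ≤ s (ω.symm (y i)) := by
  by_contra! hj
  set S := N.filter fun j => s j = s (ω.symm (y i)) with hS
  have hmaps : Set.MapsTo (fun j => ω.symm (y j)) S S := by
    intro j hjS
    simp only [hS, Finset.coe_filter, Set.mem_ofPred_eq] at hjS ⊢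
    refine ⟨hN j hjS.1, ?_⟩
    rw [hlt j hjS.1 (by omega), h.stage_eq j trivial, hjS.2]
  have hinjS : Set.InjOn (fun j => ω.symm (y j)) S := by
    intro a ha b hb hab
    simp only [hS, Finset.coe_filter, Set.mem_ofPred_eq] at ha hb
    exact hinj ha.1 hb.1 (ω.symm.injective hab)
  obtain ⟨j, hjS, hji⟩ := Finset.surjOn_of_injOn_of_card_le _ hmaps hinjS le_rfl
    (show ω.symm (y i) ∈ (S : Set (Fin n)) by simp [hS, hN i hi])
  simp only [hS, Finset.coe_filter, Set.mem_ofPred_eq] at hjS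
  have : j = i := hinj hjS.1 hi (ω.symm.injective hji)
  subst this
  omega

theorem TradesInStages.inCore {n : ℕ} {P : Fin n → Equiv.Perm (Fin n)}
    {ω : Equiv.Perm (Fin n)} {s : Fin n → ℕ} {x : Equiv.Perm (Fin n)}
    (h : TradesInStages P ω Set.univ s x) : InCore P ω x := by
  rintro N ⟨y, hinj, himg, hle, j, hj, hlt⟩
  have hN : ∀ i ∈ N, ω.symm (y i) ∈ N := by
    intro i hi
    have : y i ∈ N.image ω := himg ▸ Finset.mem_image_of_mem y hi
    obtain ⟨l, hl, hli⟩ := Finset.mem_image.1 this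
    simpa [← hli] using hl
  have key : ∀ k, ∀ i ∈ N, s i = k → y i = x i := by
    intro k
    induction k using Nat.strong_induction_on with
    | _ k ih =>
      intro i hi hik
      have h1 := h.le_stage_of_eq hinj hN (fun i hi hik => ih _ hik i hi rfl) hi hik.ge
      have h2 := h.best i trivial (ω.symm (y i)) trivial (hik ▸ h1)
      rw [Equiv.apply_symm_apply] at h2
      exact (P i).injective (le_antisymm (hle i hi) h2)
  exact hlt.ne (by rw [key _ j hj rfl])

theorem TradesInStages.eq_of_inCore {n : ℕ} {P : Fin n → Equiv.Perm (Fin n)}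
    {ω : Equiv.Perm (Fin n)} {s : Fin n → ℕ} {x y : Equiv.Perm (Fin n)}
    (h : TradesInStages P ω Set.univ s x) (hy : InCore P ω y) : y = x := by
  have key : ∀ k, ∀ i, s i = k → y i = x i := by
    intro k
    induction k using Nat.strong_induction_on with
    | _ k ih =>
      have hle : ∀ i, s i = k → P i (x i) ≤ P i (y i) := by
        intro i hik
        have h1 := h.le_stage_of_eq (N := Finset.univ) (y := y) y.injective.injOn (by simp)
          (fun i _ hik => ih _ hik i rfl) (Finset.mem_univ i) hik.ge
        simpa using h.best i trivial (ω.symm (y i)) trivial (hik ▸ h1)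
      intro i hik
      by_contra hne
      refine hy (Finset.univ.filter fun j => s j = k) ⟨x, x.injective.injOn, ?_, ?_, i, ?_, ?_⟩
      · refine Finset.eq_of_subset_of_card_le ?_ ?_
        · intro o ho
          obtain ⟨j, hj, rfl⟩ := Finset.mem_image.1 ho
          refine Finset.mem_image.2 ⟨ω.symm (x j), ?_, by simp⟩
          simpa [h.stage_eq j trivial] using hj
        · rw [Finset.card_image_of_injective _ x.injective,
            Finset.card_image_of_injective _ ω.injective]
      · intro j hj
        exact hle j (by simpa using hj)
      · simpa using hik
      · exact lt_of_le_of_ne (hle i hik) fun e => hne ((P i).injective e).symm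
  exact Equiv.ext fun i => key _ i rfl

theorem List.lookup_map_prodMk {α β : Type*} [DecidableEq α] (l : List α) (f : α → β) (i : α) :
    (l.map fun a => (a, f a)).lookup i = if i ∈ l then some (f i) else none := by
  induction l with
  | nil => simp
  | cons a l ih =>
    by_cases h : i = a
    · subst h; simp
    · have : (i == a) = false := by simpa using h
      simp [List.lookup, this, ih, h]

/-- A self-map of a list has a point of period at most the length of the list. -/
theorem List.exists_iterate_eq_of_mapsTo {α : Type*} {l : List α} {f : α → α}
    (hf : ∀ a ∈ l, f a ∈ l) (hl : l ≠ []) :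
    ∃ a ∈ l, ∃ k < l.length, f^[k + 1] a = a := by
  classical
  obtain ⟨a, ha⟩ := List.exists_mem_of_ne_nil l hl
  have hit : ∀ k, f^[k] a ∈ l := by
    intro k
    induction k with
    | zero => exact ha
    | succ k ih => rw [Function.iterate_succ_apply']; exact hf _ ih
  obtain ⟨i, hi, j, hj, hij, he⟩ := Finset.exists_ne_map_eq_of_card_lt_of_maps_to
    (s := Finset.range (l.length + 1)) (t := l.toFinset) (f := fun k => f^[k] a)
    (by simpa using Nat.lt_succ_of_le l.toFinset_card_le) (fun k _ => by simpa using hit k)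
  wlog hlt : i < j generalizing i j
  · exact this j hj i hi hij.symm he.symm (by omega)
  refine ⟨f^[i] a, hit i, j - i - 1, by simp at hj; omega, ?_⟩
  rw [← Function.iterate_add_apply, show j - i - 1 + 1 + i = j by omega]
  exact he.symm

theorem exists_tradesInStages_TTCAux {n : ℕ} (P : Fin n → Equiv.Perm (Fin n))
    (ω : Equiv.Perm (Fin n)) (fuel : ℕ) (agents objects : List (Fin n))
    (hlen : agents.length ≤ fuel) (hobj : ∀ o, o ∈ objects ↔ ω.symm o ∈ agents) :
    ∃ s, TradesInStages P ω {i | i ∈ agents} s fun i =>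
      ((TTCAux (fun j => ⇑(P j)) fuel agents objects ω.symm).lookup i).getD (ω i) := by
  induction fuel generalizing agents objects with
  | zero =>
    have : agents = [] := List.length_eq_zero_iff.1 (by omega)
    subst this
    exact ⟨0, by simp, by simp, by simp, by simp⟩
  | succ fuel ih =>
    match agents, hlen, hobj with
    | [], _, _ => exact ⟨0, by simp, by simp, by simp, by simp⟩
    | a0 :: as, hlen, hobj =>
      generalize hA : a0 :: as = A at hlen hobj
      have hAne : A ≠ [] := by simp [← hA]
      set top : Fin n → Fin n := fun a => (objects.argmin (P a)).getD a0 with htop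
      set ptr : Fin n → Fin n := fun a => ω.symm (top a) with hptr
      set onCyc : Fin n → Bool := fun a =>
        (List.range A.length).any fun k => ptr^[k + 1] a == a with honCyc
      have hunfold : TTCAux (fun j => ⇑(P j)) (fuel + 1) A objects ω.symm =
          ((A.filter onCyc).map fun a => (a, top a)) ++
            TTCAux (fun j => ⇑(P j)) fuel (A.filter fun a => !onCyc a)
              (objects.filter fun o => !(((A.filter onCyc).map top).contains o)) ω.symm := by
        subst hA; rfl
      have hone : objects ≠ [] := by
        have : ω a0 ∈ objects := (hobj _).2 (by simp [← hA])
        exact List.ne_nil_of_mem this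
      have hargmin : ∀ a, top a ∈ objects.argmin (P a) := by
        intro a
        cases he : objects.argmin (P a) with
        | none => exact absurd (List.argmin_eq_none.1 he) hone
        | some o => simp [htop, he]
      have htop_mem : ∀ a, top a ∈ objects := fun a => List.argmin_mem (hargmin a)
      have htop_le : ∀ a, ∀ o ∈ objects, P a (top a) ≤ P a o := fun a o ho =>
        List.le_of_mem_argmin ho (hargmin a)
      have hptr_mem : ∀ a, ptr a ∈ A := fun a => (hobj _).1 (htop_mem a)
      have hcyc : ∀ a, onCyc a = true ↔ ∃ k < A.length, ptr^[k + 1] a = a := by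
        intro a; simp [honCyc]
      have hcyc_ptr : ∀ a, onCyc a = true → onCyc (ptr a) = true := by
        intro a ha
        obtain ⟨k, hk, he⟩ := (hcyc a).1 ha
        refine (hcyc _).2 ⟨k, hk, ?_⟩
        rw [← Function.iterate_succ_apply, Function.iterate_succ_apply', he]
      have hcyc_mem : ∀ a, onCyc a = true → a ∈ A := by
        intro a ha
        obtain ⟨k, hk, he⟩ := (hcyc a).1 ha
        rw [← he, Function.iterate_succ_apply']
        exact hptr_mem _
      have hcyc_surj : ∀ a, onCyc a = true → ∃ b, onCyc b = true ∧ ptr b = a := by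
        intro a ha
        obtain ⟨k, hk, he⟩ := (hcyc a).1 ha
        refine ⟨ptr^[k] a, ?_, (Function.iterate_succ_apply' ptr k a).symm.trans he⟩
        clear hk he
        induction k with
        | zero => exact ha
        | succ k ih => rw [Function.iterate_succ_apply']; exact hcyc_ptr _ ih
      have hcyc_inj : ∀ a b, onCyc a = true → onCyc b = true → ptr a = ptr b → a = b := by
        have hper : ∀ a, onCyc a = true → a ∈ Function.periodicPts ptr := by
          intro a ha
          obtain ⟨k, _, he⟩ := (hcyc a).1 ha
          exact Function.mk_mem_periodicPts k.succ_pos he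
        intro a b ha hb hab
        exact (Function.bijOn_periodicPts ptr).injOn (hper a ha) (hper b hb) hab
      obtain ⟨c, hcA, hc⟩ := List.exists_iterate_eq_of_mapsTo (f := ptr)
        (fun a _ => hptr_mem a) hAne
      have hlen' : (A.filter fun a => !onCyc a).length ≤ fuel := by
        have : (A.filter fun a => !onCyc a).length < A.length :=
          List.length_filter_lt_length_iff_exists.2 ⟨c, hcA, by simp [(hcyc c).2 hc]⟩
        omega
      have hobj' : ∀ o, o ∈ objects.filter
          (fun o => !(((A.filter onCyc).map top).contains o)) ↔
          ω.symm o ∈ A.filter fun a => !onCyc a := by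
        intro o
        have : o ∈ (A.filter onCyc).map top ↔ onCyc (ω.symm o) = true := by
          simp only [List.mem_map, List.mem_filter]
          constructor
          · rintro ⟨a, ⟨-, ha⟩, rfl⟩
            exact hcyc_ptr a ha
          · intro ho
            obtain ⟨b, hb, hbo⟩ := hcyc_surj _ ho
            exact ⟨b, ⟨hcyc_mem b hb, hb⟩, ω.symm.injective hbo⟩
        rw [List.mem_filter, List.mem_filter, hobj, Bool.not_eq_true', Bool.not_eq_true',
          ← Bool.not_eq_true, ← Bool.not_eq_true, List.contains_iff_mem, this]
      obtain ⟨s, hs⟩ := ih _ _ hlen' hobj'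
      rw [hunfold]
      set L := TTCAux (fun j => ⇑(P j)) fuel (A.filter fun a => !onCyc a)
        (objects.filter fun o => !(((A.filter onCyc).map top).contains o)) ω.symm
      have hx : ∀ i, ((((A.filter onCyc).map fun a => (a, top a)) ++ L).lookup i).getD (ω i) =
          if onCyc i = true then top i else (L.lookup i).getD (ω i) := by
        intro i
        rw [List.lookup_append, List.lookup_map_prodMk]
        by_cases hi : onCyc i = true
        · simp [hi, hcyc_mem i hi]
        · simp [hi]
      simp only [hx]
      have hout : ∀ i ∈ A, onCyc i = false → i ∈ {i | i ∈ A.filter fun a => !onCyc a} := by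
        intro i hi hci
        simp [hi, hci]
      have hback : ∀ i ∈ A, onCyc i = false →
          ω.symm ((L.lookup i).getD (ω i)) ∈ A ∧
          onCyc (ω.symm ((L.lookup i).getD (ω i))) = false := by
        intro i hi hci
        simpa using hs.mapsTo i (hout i hi hci)
      refine ⟨fun i => if onCyc i = true then 0 else s i + 1, ?_, ?_, ?_, ?_⟩
      · intro i hi
        cases hci : onCyc i
        · simpa using (hback i hi hci).1
        · simpa using hptr_mem i
      · intro i hi
        cases hci : onCyc i
        · simp [(hback i hi hci).2, hs.stage_eq i (hout i hi hci)]
        · have : onCyc (ω.symm (top i)) = true := hcyc_ptr i hci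
          simp [this]
      · intro i hi j hj hij
        cases hci : onCyc i <;> cases hcj : onCyc j <;> simp only [hci, hcj] at hij
        · exact hs.injOn (hout i hi hci) (hout j hj hcj) (by simpa using hij)
        · have h1 := (hback i hi hci).2
          have h2 : onCyc (ω.symm (top j)) = true := hcyc_ptr j hcj
          replace hij : (L.lookup i).getD (ω i) = top j := by simpa using hij
          rw [hij, h2] at h1
          exact absurd h1 (by decide)
        · have h1 := (hback j hj hcj).2
          have h2 : onCyc (ω.symm (top i)) = true := hcyc_ptr i hci
          replace hij : top i = (L.lookup j).getD (ω j) := by simpa using hij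
          rw [← hij, h2] at h1
          exact absurd h1 (by decide)
        · exact hcyc_inj i j hci hcj (congrArg ω.symm (by simpa using hij))
      · intro i hi j hj hij
        cases hci : onCyc i
        · cases hcj : onCyc j
          · simpa using hs.best i (hout i hi hci) j (hout j hj hcj) (by simpa [hci, hcj] using hij)
          · simp [hci, hcj] at hij
        · simpa using htop_le i (ω j) ((hobj _).2 (by simpa using hj))

/-- for every strict preference profile and endowment profile, the core
is a singleton whose unique element is the TTC allocation. -/
theorem core_singleton_eq_ttc {n : ℕ} (hn : 1 ≤ n)
    (P : Fin n → Equiv.Perm (Fin n)) (ω : Equiv.Perm (Fin n)) :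
    ∃ x : Equiv.Perm (Fin n), ⇑x = TTCfun (fun j => ⇑(P j)) ω ∧
      ∀ y : Equiv.Perm (Fin n), InCore P ω y ↔ y = x := by
  obtain ⟨s, hs⟩ := exists_tradesInStages_TTCAux P ω n (List.finRange n) (List.finRange n)
    (by simp) (by simp)
  rw [show {i | i ∈ List.finRange n} = Set.univ by simp] at hs
  change TradesInStages P ω Set.univ s (TTCfun (fun j => ⇑(P j)) ω) at hs
  have hbij := Finite.injective_iff_bijective.1 (Set.injOn_univ.1 hs.injOn)
  refine ⟨Equiv.ofBijective _ hbij, rfl,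
    fun y => ⟨hs.eq_of_inCore (x := Equiv.ofBijective _ hbij), ?_⟩⟩
  rintro rfl
  exact hs.inCore (x := Equiv.ofBijective _ hbij)
end
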